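/- arXiv:2103.00942 — 2 statements merged into one kernel-verified Lean document; each statement's English description precedes it below -/
import Mathlib

section
/- For any fuzzy finite automaton F = (A, f) over an alphabet X, the languages D_1(F), D_2(F) and D_3(F) are regular. -/
open scoped Classical

/-- Extended fuzzy transition function `f*` of a fuzzy finite automaton. -/
noncomputable def fstar {A X : Type*} [Fintype A] [Nonempty A]
    (f : A → X → A → unitInterval) : A → List X → A → unitInterval
  | a, [], b => if b = a then 1 else 0
  | a, x :: v, b => Finset.univ.sup' Finset.univ_nonempty fun c => min (f a x c) (fstar f c v b)

/-- `F(a, w)`: the set of states reachable from `a` by `w` with positive degree. -/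
def freach {A X : Type*} [Fintype A] [Nonempty A]
    (f : A → X → A → unitInterval) (a : A) (w : List X) : Set A :=
  {b | 0 < fstar f a w b}

/-- D1-directing words of a fuzzy finite automaton. -/
def D1set {A X : Type*} [Fintype A] [Nonempty A] (f : A → X → A → unitInterval) :
    Set (List X) := {w | ∃ c, ∀ a, freach f a w = {c}}

/-- D2-directing words of a fuzzy finite automaton. -/
def D2set {A X : Type*} [Fintype A] [Nonempty A] (f : A → X → A → unitInterval) :
    Set (List X) := {w | ∀ a b, freach f a w = freach f b w}

/-- D3-directing words of a fuzzy finite automaton. -/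
def D3set {A X : Type*} [Fintype A] [Nonempty A] (f : A → X → A → unitInterval) :
    Set (List X) := {w | ∃ c, ∀ a, c ∈ freach f a w}

/-- Extended transition function of a deterministic finite automaton. -/
def dstar {Q X : Type*} (δ : Q → X → Q) : Q → List X → Q
  | q, [] => q
  | q, x :: w => dstar δ (δ q x) w

/-- A language is regular if it is recognized by a deterministic finite automaton
with an initial state and a set of final states. -/
def IsRegularLang {X : Type*} (L : Set (List X)) : Prop :=
  ∃ (Q : Type) (_ : Fintype Q) (δ : Q → X → Q) (q0 : Q) (F : Set Q),
    L = {w | dstar δ q0 w ∈ F}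

theorem isRegularLang_of_dstar {X Q : Type*} [Finite Q] (δ : Q → X → Q) (q₀ : Q) (F : Set Q) :
    IsRegularLang {w | dstar δ q₀ w ∈ F} := by
  obtain ⟨n, ⟨e⟩⟩ := Finite.exists_equiv_fin Q
  refine ⟨Fin n, inferInstance, fun q x => e (δ (e.symm q) x), e q₀, e.symm ⁻¹' F, ?_⟩
  have key : ∀ (w : List X) (q : Q),
      dstar (fun q x => e (δ (e.symm q) x)) (e q) w = e (dstar δ q w) := by
    intro w
    induction w with
    | nil => intro q; rfl
    | cons x w ih => intro q; simp [dstar, ih]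
  ext w
  simp [key]

theorem mem_freach_nil {A X : Type*} [Fintype A] [Nonempty A]
    (f : A → X → A → unitInterval) (a b : A) : b ∈ freach f a [] ↔ b = a := by
  by_cases h : b = a <;> simp [freach, fstar, h]

theorem mem_freach_cons {A X : Type*} [Fintype A] [Nonempty A]
    (f : A → X → A → unitInterval) (a b : A) (x : X) (w : List X) :
    b ∈ freach f a (x :: w) ↔ ∃ c, 0 < f a x c ∧ b ∈ freach f c w := by
  simp [freach, fstar, Finset.lt_sup'_iff]

/-- Composition of a relation with the support of the transition `f · x ·`. -/
def relStep {A X : Type*} (f : A → X → A → unitInterval) (R : A → A → Prop) (x : X) :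
    A → A → Prop :=
  fun a b => ∃ c, R a c ∧ 0 < f c x b

theorem dstar_relStep {A X : Type*} [Fintype A] [Nonempty A]
    (f : A → X → A → unitInterval) (w : List X) (R : A → A → Prop) (a b : A) :
    dstar (relStep f) R w a b ↔ ∃ c, R a c ∧ b ∈ freach f c w := by
  induction w generalizing R with
  | nil => simp [dstar, mem_freach_nil]
  | cons x w ih =>
    simp only [dstar, ih, relStep, mem_freach_cons]
    constructor
    · rintro ⟨c, ⟨d, hd, hc⟩, hb⟩
      exact ⟨d, hd, c, hc, hb⟩
    · rintro ⟨d, hd, c, hc, hb⟩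
      exact ⟨c, ⟨d, hd, hc⟩, hb⟩

/-- A language defined by a property of the reachability map `a ↦ F(a, w)` is regular. -/
theorem isRegularLang_of_freach {A X : Type*} [Fintype A] [Nonempty A]
    (f : A → X → A → unitInterval) (P : (A → Set A) → Prop) :
    IsRegularLang {w | P fun a => freach f a w} := by
  have key : ∀ w, (fun a => {b | dstar (relStep f) Eq w a b}) = fun a => freach f a w := by
    intro w
    ext a b
    simp [dstar_relStep]
  convert isRegularLang_of_dstar (relStep f) Eq {R | P fun a => {b | R a b}} using 3 with w
  simp only [Set.mem_ofPred_eq, key]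

/-- For any FFA `F`, the languages `D_1(F)`, `D_2(F)` and `D_3(F)` are regular. -/
theorem stmt4 {A X : Type*} [Fintype X] [Nonempty X] [Fintype A] [Nonempty A]
    (f : A → X → A → unitInterval) :
    IsRegularLang (D1set f) ∧ IsRegularLang (D2set f) ∧ IsRegularLang (D3set f) := by
  exact ⟨isRegularLang_of_freach f fun r => ∃ c, ∀ a, r a = {c},
    isRegularLang_of_freach f fun r => ∀ a b, r a = r b,
    isRegularLang_of_freach f fun r => ∃ c, ∀ a, c ∈ r a⟩
end

section
/- Let φ : F → G be an epimorphism of fuzzy finite automata F = (A, f) and G = (B, g) over an alphabet X. Then DD_1(F) ⊆ DD_1(G), DD_2(F) ⊆ DD_2(G) and DD_3(F) ⊆ DD_3(G); hence every epimorphic image of a DDi-directable FFA is DDi-directable (i = 1, 2, 3). Moreover, if F is normal, then so is G. -/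
open scoped Classical

/-- A word is DD1-directing: some state `c` is reached from every state with the same
positive degree `r`, and no other state is reachable. -/
def IsDD1 {A X : Type*} [Fintype A] [Nonempty A] (f : A → X → A → unitInterval)
    (w : List X) : Prop :=
  ∃ (c : A) (r : unitInterval), 0 < r ∧
    ∀ a, fstar f a w c = r ∧ ∀ b, b ≠ c → fstar f a w b = 0

/-- A word is DD2-directing: the fuzzy set of reached states is independent of the start. -/
def IsDD2 {A X : Type*} [Fintype A] [Nonempty A] (f : A → X → A → unitInterval)
    (w : List X) : Prop :=
  ∀ a b c, fstar f a w c = fstar f b w c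

/-- A word is DD3-directing: some state `c` has positive and maximal reachability degree
from every state. -/
def IsDD3 {A X : Type*} [Fintype A] [Nonempty A] (f : A → X → A → unitInterval)
    (w : List X) : Prop :=
  ∃ c, ∀ a, 0 < fstar f a w c ∧ ∀ b, fstar f a w b ≤ fstar f a w c

def DD1set {A X : Type*} [Fintype A] [Nonempty A] (f : A → X → A → unitInterval) :
    Set (List X) := {w | IsDD1 f w}

def DD2set {A X : Type*} [Fintype A] [Nonempty A] (f : A → X → A → unitInterval) :
    Set (List X) := {w | IsDD2 f w}

def DD3set {A X : Type*} [Fintype A] [Nonempty A] (f : A → X → A → unitInterval) :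
    Set (List X) := {w | IsDD3 f w}

/-- Along an epimorphism `phi` of fuzzy finite automata, `fstar g (phi a) w b` is the greatest of
the degrees `fstar f a w a'` over the fibre of `b`. -/
theorem isGreatest_fstar_image_fiber {A B X : Type*} [Fintype A] [Nonempty A]
    [Fintype B] [Nonempty B]
    {f : A → X → A → unitInterval} {g : B → X → B → unitInterval}
    {phi : A → B} (hsurj : Function.Surjective phi)
    (hhom : ∀ (a : A) (x : X) (b : B),
      (∃ a', phi a' = b ∧ g (phi a) x b = f a x a') ∧
      (∀ a', phi a' = b → f a x a' ≤ g (phi a) x b))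
    (w : List X) (a : A) (b : B) :
    (∃ a', phi a' = b ∧ fstar g (phi a) w b = fstar f a w a') ∧
      ∀ a', phi a' = b → fstar f a w a' ≤ fstar g (phi a) w b := by
  induction w generalizing a b with
  | nil =>
    simp only [fstar]
    constructor
    · by_cases h : b = phi a
      · exact ⟨a, h.symm, by simp [h]⟩
      · obtain ⟨a', rfl⟩ := hsurj b
        have ha : a' ≠ a := fun e => h (congrArg phi e)
        exact ⟨a', rfl, by simp [h, ha]⟩
    · rintro a' rfl
      by_cases h : a' = a
      · simp [h]
      · simp [h]
  | cons x v ih =>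
    have upper : ∀ a', phi a' = b → fstar f a (x :: v) a' ≤ fstar g (phi a) (x :: v) b := by
      intro a' ha'
      simp only [fstar]
      refine Finset.sup'_le _ _ fun c _ => ?_
      exact (min_le_min ((hhom a x (phi c)).2 c rfl) ((ih c b).2 a' ha')).trans
        (Finset.le_sup' (fun d => min (g (phi a) x d) (fstar g d v b)) (Finset.mem_univ (phi c)))
    refine ⟨?_, upper⟩
    obtain ⟨d, -, hd⟩ := Finset.exists_mem_eq_sup' Finset.univ_nonempty
      fun d => min (g (phi a) x d) (fstar g d v b)
    obtain ⟨c, rfl, hc⟩ := (hhom a x d).1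
    obtain ⟨a', ha', hv⟩ := (ih c b).1
    refine ⟨a', ha', le_antisymm ?_ (upper a' ha')⟩
    simp only [fstar]
    rw [hd, hc, hv]
    exact Finset.le_sup' (fun c => min (f a x c) (fstar f c v a')) (Finset.mem_univ c)

/-- If `φ : F → G` is an epimorphism of FFAs, then `DD_i(F) ⊆ DD_i(G)` for `i = 1, 2, 3`
(hence every epimorphic image of a DDi-directable FFA is DDi-directable), and if `F` is
normal then so is `G`. -/
theorem stmt18 {A B X : Type*} [Fintype X] [Nonempty X] [Fintype A] [Nonempty A]
    [Fintype B] [Nonempty B]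
    (f : A → X → A → unitInterval) (g : B → X → B → unitInterval)
    (phi : A → B) (hsurj : Function.Surjective phi)
    (hhom : ∀ (a : A) (x : X) (b : B),
      (∃ a', phi a' = b ∧ g (phi a) x b = f a x a') ∧
      (∀ a', phi a' = b → f a x a' ≤ g (phi a) x b)) :
    (∀ w : List X, IsDD1 f w → IsDD1 g w) ∧
    (∀ w : List X, IsDD2 f w → IsDD2 g w) ∧
    (∀ w : List X, IsDD3 f w → IsDD3 g w) ∧
    ((∀ (a : A) (x : X), ∃ c, f a x c = 1) →
      ∀ (b : B) (x : X), ∃ c, g b x c = 1) := by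
  have key := isGreatest_fstar_image_fiber hsurj hhom
  refine ⟨?_, ?_, ?_, ?_⟩
  · rintro w ⟨c, r, hr, h⟩
    refine ⟨phi c, r, hr, hsurj.forall.2 fun a => ⟨?_, fun b hb => ?_⟩⟩
    · refine le_antisymm ?_ ((h a).1 ▸ (key w a (phi c)).2 c rfl)
      obtain ⟨a', -, h'⟩ := (key w a (phi c)).1
      rw [h']
      by_cases hac : a' = c
      · rw [hac, (h a).1]
      · rw [(h a).2 a' hac]
        exact hr.le
    · obtain ⟨a', rfl, h'⟩ := (key w a b).1
      rw [h']
      exact (h a).2 a' fun e => hb (congrArg phi e)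
  · intro w h
    have le : ∀ a a' b, fstar g (phi a) w b ≤ fstar g (phi a') w b := by
      intro a a' b
      obtain ⟨d, hd, h'⟩ := (key w a b).1
      rw [h', h a a' d]
      exact (key w a' b).2 d hd
    exact hsurj.forall.2 fun a => hsurj.forall.2 fun a' b => le_antisymm (le a a' b) (le a' a b)
  · rintro w ⟨c, h⟩
    refine ⟨phi c, hsurj.forall.2 fun a => ?_⟩
    have hc := (key w a (phi c)).2 c rfl
    refine ⟨(h a).1.trans_le hc, fun b => ?_⟩
    obtain ⟨a', -, h'⟩ := (key w a b).1
    rw [h']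
    exact ((h a).2 a').trans hc
  · intro h
    refine hsurj.forall.2 fun a x => ?_
    obtain ⟨c, hc⟩ := h a x
    exact ⟨phi c, le_antisymm unitInterval.le_one' (hc ▸ (hhom a x (phi c)).2 c rfl)⟩
end
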